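/- Fix 0 < q < 1 and let g : [0,∞) → ℝ be defined by g(x) = e^{−(1+c_q)x} ∑_{j=0}^{⌊x/log(1/q)⌋} q^{−j(1+c_q)} ∑_{k=0}^{j} ((x − j·log(1/q))^k / k!) · w_k(j), where c_q = ∑_{k=1}^∞ q^k/(1-q^k) and w_k(j) = ∑_{p_1+...+p_k=j, p_i≥1} ∏_{i=1}^k q^{2p_i}/(1-q^{p_i}) (with w_0(0)=1, w_0(j)=0 for j≥1). Then the measure ν_q on (0,1] with density t ↦ g(log(1/t))/((1-q)·t) with respect to Lebesgue measure is a probability measure whose moments are q-analogues of the reciprocal harmonic numbers: for every integer n ≥ 0, ∫_0^1 t^n dν_q(t) = (∑_{k=0}^{n} (1-q)/(1-q^{k+1}))^{−1}. -/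

import Mathlib

open MeasureTheory

/-- The Bernstein transform of the Jackson measure `d_q t`. -/
noncomputable def fq (q : ℝ) (z : ℂ) : ℂ :=
  (1 - q) * (z + ∑' k : ℕ,
    (q : ℂ) ^ (k + 1) * (1 - (q : ℂ) ^ (((k : ℂ) + 1) * z)) / (1 - (q : ℂ) ^ (k + 1)))

/-- `c_q = ∑_{k=1}^∞ q^k/(1-q^k)`. -/
noncomputable def cq (q : ℝ) : ℝ := ∑' k : ℕ, q ^ (k + 1) / (1 - q ^ (k + 1))

/-- `w q k j = ∑_{p_1+⋯+p_k=j, p_i ≥ 1} ∏_i q^{2 p_i}/(1-q^{p_i})`, the mass at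
`j log(1/q)` of the `k`-th convolution power of `∑_{p≥1} (q^{2p}/(1-q^p)) δ_{p log(1/q)}`. -/
noncomputable def w (q : ℝ) (k j : ℕ) : ℝ :=
  ∑ p ∈ (Finset.Nat.antidiagonalTuple k j).filter (fun p => ∀ i, 1 ≤ p i),
    ∏ i, q ^ (2 * p i) / (1 - q ^ (p i))

/-- `(1-q)` times the density of the measure `τ_q`. -/
noncomputable def g (q : ℝ) (x : ℝ) : ℝ :=
  Real.exp (-(1 + cq q) * x) *
    ∑ j ∈ Finset.range (⌊x / Real.log (1 / q)⌋₊ + 1),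
      q ^ (-(j : ℝ) * (1 + cq q)) *
        ∑ k ∈ Finset.range (j + 1),
          (x - j * Real.log (1 / q)) ^ k / (Nat.factorial k) * w q k j

/-- The measure `ν_q` on `(0,1]` with density `t ↦ g(log(1/t))/((1-q) t)` w.r.t.
Lebesgue measure. -/
noncomputable def nuq (q : ℝ) : Measure ℝ :=
  (volume.restrict (Set.Ioc (0:ℝ) 1)).withDensity
    fun t => ENNReal.ofReal (g q (Real.log (1 / t)) / ((1 - q) * t))

open ProbabilityTheory ENNReal

lemma ENNReal.tsum_fin_prod (f : ℕ → ℝ≥0∞) (k : ℕ) :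
    ∑' p : Fin k → ℕ, ∏ i, f (p i) = (∑' m, f m) ^ k := by
  induction k with
  | zero => simp [tsum_fintype]
  | succ k ih =>
    rw [← (Fin.consEquiv fun _ : Fin (k + 1) => ℕ).tsum_eq, ENNReal.tsum_prod']
    simp only [Fin.consEquiv, Equiv.coe_fn_mk, Fin.prod_univ_succ, Fin.cons_zero, Fin.cons_succ,
      ENNReal.tsum_mul_left, ih, ENNReal.tsum_mul_right]
    rw [pow_succ']

lemma ENNReal.tsum_sum_antidiagonalTuple (f : ℕ → ℝ≥0∞) (k : ℕ) :
    ∑' j, ∑ p ∈ Finset.Nat.antidiagonalTuple k j, ∏ i, f (p i) = (∑' m, f m) ^ k := by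
  rw [← ENNReal.tsum_fin_prod, ← (Finset.Nat.sigmaAntidiagonalTupleEquivTuple k).tsum_eq,
    ENNReal.tsum_sigma']
  refine tsum_congr fun j => ?_
  rw [tsum_fintype]
  exact (Finset.sum_coe_sort (Finset.Nat.antidiagonalTuple k j)
    fun p : Fin k → ℕ => ∏ i, f (p i)).symm

lemma jump_nonneg {q : ℝ} (hq0 : 0 < q) (hq1 : q < 1) (p : ℕ) :
    0 ≤ q ^ (2 * p) / (1 - q ^ p) :=
  div_nonneg (by positivity) (sub_nonneg.2 (pow_le_one₀ hq0.le hq1.le))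

/-- The condition `1 ≤ p i` in `w` is automatic, since the factor at `p i = 0` is `1 / 0 = 0`. -/
lemma w_eq_sum_antidiagonalTuple (q : ℝ) (k j : ℕ) :
    w q k j = ∑ p ∈ Finset.Nat.antidiagonalTuple k j, ∏ i, q ^ (2 * p i) / (1 - q ^ (p i)) := by
  refine Finset.sum_filter_of_ne fun p _ hp i => ?_
  by_contra h
  refine hp (Finset.prod_eq_zero (Finset.mem_univ i) ?_)
  simp [show p i = 0 by omega]

lemma w_nonneg {q : ℝ} (hq0 : 0 < q) (hq1 : q < 1) (k j : ℕ) : 0 ≤ w q k j := by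
  rw [w_eq_sum_antidiagonalTuple]
  exact Finset.sum_nonneg fun p _ => Finset.prod_nonneg fun i _ => jump_nonneg hq0 hq1 _

lemma w_eq_zero (q : ℝ) {k j : ℕ} (h : j < k) : w q k j = 0 := by
  refine Finset.sum_eq_zero fun p hp => ?_
  rw [Finset.mem_filter, Finset.Nat.mem_antidiagonalTuple] at hp
  have : ∑ _i : Fin k, 1 ≤ ∑ i, p i := Finset.sum_le_sum fun i _ => hp.2 i
  simp at this
  omega

/-- The generating function of `j ↦ w q k j` is the `k`-th power of that of the jump weights. -/
lemma tsum_w {q : ℝ} (hq0 : 0 < q) (hq1 : q < 1) (k : ℕ) {s : ℝ} (hs : 0 ≤ s) :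
    ∑' j, ENNReal.ofReal (w q k j * s ^ j) =
      (∑' p : ℕ, ENNReal.ofReal (q ^ (2 * p) / (1 - q ^ p) * s ^ p)) ^ k := by
  rw [← ENNReal.tsum_sum_antidiagonalTuple]
  refine tsum_congr fun j => ?_
  have h : ∀ p, 0 ≤ q ^ (2 * p) / (1 - q ^ p) * s ^ p :=
    fun p => mul_nonneg (jump_nonneg hq0 hq1 p) (by positivity)
  rw [w_eq_sum_antidiagonalTuple, Finset.sum_mul,
    ENNReal.ofReal_sum_of_nonneg fun p _ => mul_nonneg
      (Finset.prod_nonneg fun i _ => jump_nonneg hq0 hq1 _) (by positivity)]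
  refine Finset.sum_congr rfl fun p hp => ?_
  rw [← ENNReal.ofReal_prod_of_nonneg fun i _ => h (p i), Finset.prod_mul_distrib,
    Finset.prod_pow_eq_pow_sum, Finset.Nat.mem_antidiagonalTuple.1 hp]

lemma summable_cq {q : ℝ} (hq0 : 0 < q) (hq1 : q < 1) :
    Summable fun k : ℕ => q ^ (k + 1) / (1 - q ^ (k + 1)) := by
  have hs : Summable fun k : ℕ => q ^ (k + 1) / (1 - q) :=
    ((summable_nat_add_iff 1).2 (summable_geometric_of_lt_one hq0.le hq1)).div_const _
  refine hs.of_nonneg_of_le (fun k => ?_) fun k => ?_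
  · exact div_nonneg (by positivity) (sub_nonneg.2 (pow_le_one₀ hq0.le hq1.le))
  · refine div_le_div_of_nonneg_left (by positivity) (by linarith) ?_
    exact sub_le_sub_left (pow_le_of_le_one hq0.le hq1.le (Nat.succ_ne_zero k)) 1

lemma cq_nonneg {q : ℝ} (hq0 : 0 < q) (hq1 : q < 1) : 0 ≤ cq q :=
  tsum_nonneg fun _ => div_nonneg (by positivity) (sub_nonneg.2 (pow_le_one₀ hq0.le hq1.le))

lemma hasSum_pow_div {q : ℝ} (hq0 : 0 < q) (hq1 : q < 1) (n : ℕ) :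
    HasSum (fun k : ℕ => q ^ ((n + 1) * (k + 1)) / (1 - q ^ (k + 1)))
      (n + cq q - ∑ k ∈ Finset.range n, 1 / (1 - q ^ (k + 1))) := by
  induction n with
  | zero => simpa [cq] using (summable_cq hq0 hq1).hasSum
  | succ n ih =>
    have hr : q ^ (n + 1) < 1 := pow_lt_one₀ hq0.le hq1 (Nat.succ_ne_zero n)
    have hg : HasSum (fun k : ℕ => q ^ ((n + 1) * (k + 1))) (q ^ (n + 1) * (1 - q ^ (n + 1))⁻¹) := by
      convert! (hasSum_geometric_of_lt_one (by positivity) hr).mul_left (q ^ (n + 1)) using 2 with k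
      rw [pow_mul, pow_succ']
    convert! ih.sub hg using 1
    · ext k
      have : 1 - q ^ (k + 1) ≠ 0 := by
        have := pow_lt_one₀ hq0.le hq1 (Nat.succ_ne_zero k)
        simp only [Nat.succ_eq_add_one] at this
        linarith
      field_simp
      ring
    · have : 1 - q ^ (n + 1) ≠ 0 := by linarith
      rw [Finset.sum_range_succ]
      push_cast
      field_simp
      ring

lemma hasSum_jump {q : ℝ} (hq0 : 0 < q) (hq1 : q < 1) (n : ℕ) :
    HasSum (fun p : ℕ => q ^ (2 * p) / (1 - q ^ p) * (q ^ n) ^ p)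
      (n + 1 + cq q - ∑ k ∈ Finset.range (n + 1), 1 / (1 - q ^ (k + 1))) := by
  rw [← hasSum_nat_add_iff' 1]
  convert! hasSum_pow_div hq0 hq1 (n + 1) using 1
  · ext k
    ring
  · simp

/-- The summands of the renewal series of `x ↦ exp (-n x) g(x)`, written with gamma densities. -/
noncomputable def renewalTerm (q : ℝ) (n j k : ℕ) (x : ℝ) : ℝ≥0∞ :=
  ENNReal.ofReal (w q k j * (q ^ n) ^ j) * ENNReal.ofReal ((n + 1 + cq q)⁻¹) ^ (k + 1) *
    gammaPDF (k + 1) (n + 1 + cq q) (x - j * Real.log (1 / q))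

lemma measurable_renewalTerm (q : ℝ) (n j k : ℕ) : Measurable (renewalTerm q n j k) := by
  unfold renewalTerm gammaPDF
  fun_prop

lemma lintegral_renewalTerm {q : ℝ} (hq0 : 0 < q) (hq1 : q < 1) (n j k : ℕ) :
    ∫⁻ x, renewalTerm q n j k x =
      ENNReal.ofReal (w q k j * (q ^ n) ^ j) * ENNReal.ofReal ((n + 1 + cq q)⁻¹) ^ (k + 1) := by
  have hc := cq_nonneg hq0 hq1
  unfold renewalTerm
  rw [lintegral_const_mul _ (by unfold gammaPDF; fun_prop),
    lintegral_sub_right_eq_self (fun x => gammaPDF (k + 1) (n + 1 + cq q) x),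
    lintegral_gammaPDF_eq_one (by positivity) (by positivity), mul_one]

lemma renewalTerm_of_lt {q : ℝ} (n : ℕ) {j : ℕ} (k : ℕ) {x : ℝ}
    (h : x < j * Real.log (1 / q)) : renewalTerm q n j k x = 0 := by
  rw [renewalTerm, gammaPDF_of_neg (by linarith), mul_zero]

lemma renewalTerm_of_le {q : ℝ} (hq0 : 0 < q) (hq1 : q < 1) (n j k : ℕ) {x : ℝ}
    (h : j * Real.log (1 / q) ≤ x) :
    renewalTerm q n j k x = ENNReal.ofReal (Real.exp (-(n * x)) * (Real.exp (-(1 + cq q) * x) *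
      (q ^ (-(j : ℝ) * (1 + cq q)) *
        ((x - j * Real.log (1 / q)) ^ k / (Nat.factorial k) * w q k j)))) := by
  have hc := cq_nonneg hq0 hq1
  have hw := w_nonneg hq0 hq1 k j
  have hr : (0 : ℝ) < n + 1 + cq q := by positivity
  rw [renewalTerm, gammaPDF_of_nonneg (by linarith), ← ENNReal.ofReal_pow (by positivity),
    ← ENNReal.ofReal_mul (by positivity), ← ENNReal.ofReal_mul (by positivity)]
  congr 1
  have e1 : (q ^ n) ^ j = Real.exp (-(n * j * Real.log (1 / q))) := by
    rw [← pow_mul, ← Real.rpow_natCast, Real.rpow_def_of_pos hq0]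
    simp
    ring
  have e2 : q ^ (-(j : ℝ) * (1 + cq q)) = Real.exp (j * (1 + cq q) * Real.log (1 / q)) := by
    rw [Real.rpow_def_of_pos hq0]
    simp
    ring
  have e3 : Real.exp (-(n * x)) * Real.exp (-(1 + cq q) * x) *
      Real.exp (j * (1 + cq q) * Real.log (1 / q)) =
      Real.exp (-(n * j * Real.log (1 / q))) *
        Real.exp (-((n + 1 + cq q) * (x - j * Real.log (1 / q)))) := by
    simp only [← Real.exp_add]
    ring_nf
  have e4 : (n + 1 + cq q) ^ ((k : ℝ) + 1) = (n + 1 + cq q) ^ (k + 1) := by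
    exact_mod_cast Real.rpow_natCast (n + 1 + cq q) (k + 1)
  rw [e1, e2, e4, Real.Gamma_nat_eq_factorial, add_sub_cancel_right, Real.rpow_natCast, inv_pow]
  have hr' := (pow_pos hr (k + 1)).ne'
  calc _ = (Real.exp (-(n * j * Real.log (1 / q))) *
        Real.exp (-((n + 1 + cq q) * (x - j * Real.log (1 / q))))) *
        ((x - j * Real.log (1 / q)) ^ k / (Nat.factorial k) * w q k j) *
        (((n + 1 + cq q) ^ (k + 1))⁻¹ * (n + 1 + cq q) ^ (k + 1)) := by ring
    _ = _ := by
      rw [inv_mul_cancel₀ hr', ← e3]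
      ring

lemma ofReal_exp_mul_g {q : ℝ} (hq0 : 0 < q) (hq1 : q < 1) (n : ℕ) {x : ℝ} (hx : 0 ≤ x) :
    ENNReal.ofReal (Real.exp (-(n * x)) * g q x) = ∑' j, ∑' k, renewalTerm q n j k x := by
  have hL : 0 < Real.log (1 / q) := Real.log_pos (one_lt_one_div hq0 hq1)
  have hle : ∀ j ∈ Finset.range (⌊x / Real.log (1 / q)⌋₊ + 1), j * Real.log (1 / q) ≤ x := by
    intro j hj
    rw [← le_div_iff₀ hL, ← Nat.le_floor_iff (by positivity)]
    exact Nat.lt_succ_iff.1 (Finset.mem_range.1 hj)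
  have hnn : ∀ j ∈ Finset.range (⌊x / Real.log (1 / q)⌋₊ + 1), ∀ k,
      0 ≤ Real.exp (-(n * x)) * (Real.exp (-(1 + cq q) * x) *
      (q ^ (-(j : ℝ) * (1 + cq q)) *
        ((x - j * Real.log (1 / q)) ^ k / (Nat.factorial k) * w q k j))) := by
    intro j hj k
    have := w_nonneg hq0 hq1 k j
    have := sub_nonneg.2 (hle j hj)
    positivity
  rw [tsum_eq_sum (s := Finset.range (⌊x / Real.log (1 / q)⌋₊ + 1))]
  · rw [g]
    simp only [Finset.mul_sum]
    rw [ENNReal.ofReal_sum_of_nonneg fun j hj => Finset.sum_nonneg fun k _ => hnn j hj k]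
    refine Finset.sum_congr rfl fun j hj => ?_
    rw [ENNReal.ofReal_sum_of_nonneg fun k _ => hnn j hj k,
      tsum_eq_sum (s := Finset.range (j + 1))]
    · exact Finset.sum_congr rfl fun k _ => (renewalTerm_of_le hq0 hq1 n j k (hle j hj)).symm
    · intro k hk
      rw [renewalTerm, w_eq_zero q (by rw [Finset.mem_range] at hk; omega)]
      simp
  · intro j hj
    refine ENNReal.tsum_eq_zero.2 fun k => renewalTerm_of_lt n k ?_
    rw [← div_lt_iff₀ hL, ← Nat.floor_lt (by positivity)]
    rw [Finset.mem_range] at hj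
    omega

lemma g_nonneg {q : ℝ} (hq0 : 0 < q) (hq1 : q < 1) {x : ℝ} (hx : 0 ≤ x) : 0 ≤ g q x := by
  have hL : 0 < Real.log (1 / q) := Real.log_pos (one_lt_one_div hq0 hq1)
  refine mul_nonneg (Real.exp_nonneg _) (Finset.sum_nonneg fun j hj =>
    mul_nonneg (by positivity) (Finset.sum_nonneg fun k _ => ?_))
  have : j * Real.log (1 / q) ≤ x := by
    rw [← le_div_iff₀ hL, ← Nat.le_floor_iff (by positivity)]
    exact Nat.lt_succ_iff.1 (Finset.mem_range.1 hj)
  have := sub_nonneg.2 this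
  have := w_nonneg hq0 hq1 k j
  positivity

/-- The Laplace transform of `g` at the natural number `n`. -/
lemma lintegral_exp_mul_g {q : ℝ} (hq0 : 0 < q) (hq1 : q < 1) (n : ℕ) :
    ∫⁻ x in Set.Ici 0, ENNReal.ofReal (Real.exp (-(n * x)) * g q x) =
      ENNReal.ofReal (∑ k ∈ Finset.range (n + 1), 1 / (1 - q ^ (k + 1)))⁻¹ := by
  have hc := cq_nonneg hq0 hq1
  have hL : 0 < Real.log (1 / q) := Real.log_pos (one_lt_one_div hq0 hq1)
  have hr : (0 : ℝ) < n + 1 + cq q := by positivity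
  have hS := hasSum_jump hq0 hq1 n
  set r := (n : ℝ) + 1 + cq q with hr_def
  set H := ∑ k ∈ Finset.range (n + 1), 1 / (1 - q ^ (k + 1))
  have hH : 0 < H := by
    refine Finset.sum_pos (fun k _ => ?_) (by simp)
    have : q ^ (k + 1) < 1 := pow_lt_one₀ hq0.le hq1 (Nat.succ_ne_zero k)
    exact one_div_pos.2 (by linarith)
  have hjump : ∀ p : ℕ, 0 ≤ q ^ (2 * p) / (1 - q ^ p) * (q ^ n) ^ p :=
    fun p => mul_nonneg (jump_nonneg hq0 hq1 p) (by positivity)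
  have hS0 : 0 ≤ r - H := hS.nonneg hjump
  calc ∫⁻ x in Set.Ici 0, ENNReal.ofReal (Real.exp (-(n * x)) * g q x)
      = ∫⁻ x, ∑' j, ∑' k, renewalTerm q n j k x := by
        rw [← lintegral_indicator measurableSet_Ici]
        refine lintegral_congr fun x => ?_
        by_cases hx : 0 ≤ x
        · rw [Set.indicator_of_mem (Set.mem_Ici.2 hx), ofReal_exp_mul_g hq0 hq1 n hx]
        · rw [Set.indicator_of_notMem (by simpa using hx)]
          refine (ENNReal.tsum_eq_zero.2 fun j => ENNReal.tsum_eq_zero.2 fun k =>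
            renewalTerm_of_lt n k ?_).symm
          have : 0 ≤ j * Real.log (1 / q) := by positivity
          linarith
    _ = ∑' j, ∑' k, ENNReal.ofReal (w q k j * (q ^ n) ^ j) * ENNReal.ofReal r⁻¹ ^ (k + 1) := by
        rw [lintegral_tsum fun j =>
          (Measurable.tsum fun k => measurable_renewalTerm q n j k).aemeasurable]
        refine tsum_congr fun j => ?_
        rw [lintegral_tsum fun k => (measurable_renewalTerm q n j k).aemeasurable]
        exact tsum_congr fun k => lintegral_renewalTerm hq0 hq1 n j k
    _ = ∑' k, ENNReal.ofReal r⁻¹ * (ENNReal.ofReal (r - H) * ENNReal.ofReal r⁻¹) ^ k := by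
        rw [ENNReal.tsum_comm]
        refine tsum_congr fun k => ?_
        rw [ENNReal.tsum_mul_right, tsum_w hq0 hq1 k (by positivity),
          ← ENNReal.ofReal_tsum_of_nonneg hjump hS.summable, hS.tsum_eq]
        ring
    _ = ENNReal.ofReal H⁻¹ := by
        rw [ENNReal.tsum_mul_left, ENNReal.tsum_geometric, ← ENNReal.ofReal_mul hS0,
          ← ENNReal.ofReal_one, ← ENNReal.ofReal_sub _ (by positivity)]
        have h1 : 1 - (r - H) * r⁻¹ = H * r⁻¹ := by
          field_simp
          ring
        rw [h1, ← ENNReal.ofReal_inv_of_pos (by positivity),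
          ← ENNReal.ofReal_mul (by positivity)]
        congr 1
        field_simp

lemma image_exp_neg_Ici : (fun x : ℝ => Real.exp (-x)) '' Set.Ici 0 = Set.Ioc 0 1 := by
  ext t
  constructor
  · rintro ⟨x, hx, rfl⟩
    exact ⟨Real.exp_pos _, Real.exp_le_one_iff.2 (neg_nonpos.2 hx)⟩
  · rintro ⟨h0, h1⟩
    exact ⟨-Real.log t, neg_nonneg.2 (Real.log_nonpos h0.le h1), by simp [Real.exp_log h0]⟩

lemma lintegral_Ioc_eq_lintegral_exp_neg (f : ℝ → ℝ≥0∞) :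
    ∫⁻ t in Set.Ioc 0 1, f t =
      ∫⁻ x in Set.Ici 0, ENNReal.ofReal (Real.exp (-x)) * f (Real.exp (-x)) := by
  rw [← image_exp_neg_Ici, lintegral_image_eq_lintegral_abs_deriv_mul (f' := fun x => -Real.exp (-x))
    measurableSet_Ici (fun x _ => ?_) (fun x _ y _ h => by simpa using h)]
  · simp
  · simpa using ((hasDerivAt_neg x).exp).hasDerivWithinAt

lemma aemeasurable_density {q : ℝ} (hq0 : 0 < q) (hq1 : q < 1) :
    AEMeasurable (fun t => ENNReal.ofReal (g q (Real.log (1 / t)) / ((1 - q) * t)))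
      (volume.restrict (Set.Ioc (0 : ℝ) 1)) := by
  have hm : Measurable fun x => ∑' j, ∑' k, renewalTerm q 0 j k x :=
    Measurable.tsum fun j => Measurable.tsum fun k => measurable_renewalTerm q 0 j k
  have hlog : Measurable fun t : ℝ => Real.log (1 / t) := by fun_prop
  refine ⟨fun t => (∑' j, ∑' k, renewalTerm q 0 j k (Real.log (1 / t))) *
    ENNReal.ofReal (((1 - q) * t)⁻¹), (hm.comp hlog).mul (by fun_prop), ?_⟩
  refine (ae_restrict_iff' measurableSet_Ioc).2 (ae_of_all _ fun t ht => ?_)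
  have hx : 0 ≤ Real.log (1 / t) := Real.log_nonneg (one_le_one_div ht.1 ht.2)
  dsimp only
  rw [← ofReal_exp_mul_g hq0 hq1 0 hx, ← ENNReal.ofReal_mul (by
    simpa using g_nonneg hq0 hq1 hx)]
  simp [div_eq_mul_inv]

lemma lintegral_pow_nuq {q : ℝ} (hq0 : 0 < q) (hq1 : q < 1) (n : ℕ) :
    ∫⁻ t, ENNReal.ofReal (t ^ n) ∂(nuq q) =
      ENNReal.ofReal (∑ k ∈ Finset.range (n + 1), (1 - q) / (1 - q ^ (k + 1)))⁻¹ := by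
  have h1q : 0 < 1 - q := sub_pos.2 hq1
  rw [nuq, lintegral_withDensity_eq_lintegral_mul₀ (aemeasurable_density hq0 hq1) (by fun_prop),
    lintegral_Ioc_eq_lintegral_exp_neg]
  calc _ = ∫⁻ x in Set.Ici 0,
        ENNReal.ofReal (1 - q)⁻¹ * ENNReal.ofReal (Real.exp (-(n * x)) * g q x) := by
        refine setLIntegral_congr_fun measurableSet_Ici fun x hx => ?_
        have hg := g_nonneg hq0 hq1 hx
        have hlog : Real.log (1 / Real.exp (-x)) = x := by simp
        simp only [Pi.mul_apply, hlog]
        rw [← ENNReal.ofReal_mul (by positivity), ← ENNReal.ofReal_mul (by positivity),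
          ← ENNReal.ofReal_mul (by positivity), ← Real.exp_nat_mul, mul_neg]
        congr 1
        have := (Real.exp_pos (-x)).ne'
        field_simp
    _ = _ := by
        rw [lintegral_const_mul' _ _ ENNReal.ofReal_ne_top, lintegral_exp_mul_g hq0 hq1,
          ← ENNReal.ofReal_mul (by positivity), ← mul_inv, Finset.mul_sum]
        simp only [mul_one_div]

theorem stmt16 (q : ℝ) (hq0 : 0 < q) (hq1 : q < 1) :
    IsProbabilityMeasure (nuq q) ∧
      ∀ n : ℕ, ∫ t, t ^ n ∂(nuq q) =
        (∑ k ∈ Finset.range (n + 1), (1 - q) / (1 - q ^ (k + 1)))⁻¹ := by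
  have h1q : 0 < 1 - q := sub_pos.2 hq1
  refine ⟨⟨?_⟩, fun n => ?_⟩
  · have h := lintegral_pow_nuq hq0 hq1 0
    simpa [div_self h1q.ne'] using h
  · have hnn : 0 ≤ᵐ[nuq q] fun t => t ^ n := by
      refine (withDensity_absolutelyContinuous _ _).ae_le ?_
      exact (ae_restrict_iff' measurableSet_Ioc).2 (ae_of_all _ fun t ht => pow_nonneg ht.1.le n)
    rw [integral_eq_lintegral_of_nonneg_ae hnn (by fun_prop), lintegral_pow_nuq hq0 hq1,
      ENNReal.toReal_ofReal]
    refine inv_nonneg.2 (Finset.sum_nonneg fun k _ => div_nonneg h1q.le ?_)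
    exact sub_nonneg.2 (pow_le_one₀ hq0.le hq1.le)
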